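/- Call an arc (s_δ, t_δ) of the spine of a triangulation T ordered if s_δ < t_δ. For every ℓ with 0 ≤ ℓ ≤ n, the number of triangulations T of P whose spine has exactly ℓ ordered arcs equals the number of triangulations T of P whose spine has exactly n−ℓ ordered arcs. -/

import Mathlib

attribute [local instance] Classical.propDecidable

noncomputable section

namespace Spines

/-- Position of vertex `v ∈ {0,…,n+2}` in the counterclockwise boundary cyclic order:
`0`, then the elements of `D` in increasing order, then `n+2`, then the elements of `U`
in decreasing order. -/
def pos (n : ℕ) (D U : Finset ℕ) (v : ℕ) : ℕ :=
  if v = 0 then 0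
  else if v = n + 2 then D.card + 1
  else if v ∈ D then 1 + (D.filter (fun d => d < v)).card
  else D.card + 2 + (U.filter (fun u => v < u)).card

/-- Cyclic distance from `a` to `v` in counterclockwise direction. -/
def relpos (n : ℕ) (D U : Finset ℕ) (a v : ℕ) : ℕ :=
  (pos n D U v + (n + 3) - pos n D U a) % (n + 3)

/-- `v` lies strictly inside the counterclockwise boundary arc from `a` to `b`. -/
def StrictBetween (n : ℕ) (D U : Finset ℕ) (a b v : ℕ) : Prop :=
  v ≤ n + 2 ∧ 0 < relpos n D U a v ∧ relpos n D U a v < relpos n D U a b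

/-- A diagonal, encoded as an ordered pair `(a,b)` with `a < b ≤ n+2`. -/
def IsDiag (n : ℕ) (δ : ℕ × ℕ) : Prop := δ.1 < δ.2 ∧ δ.2 ≤ n + 2

/-- A boundary edge: the endpoints are adjacent in the cyclic order. -/
def IsBoundaryEdge (n : ℕ) (D U : Finset ℕ) (δ : ℕ × ℕ) : Prop :=
  IsDiag n δ ∧ (relpos n D U δ.1 δ.2 = 1 ∨ relpos n D U δ.2 δ.1 = 1)

/-- An internal diagonal. -/
def IsInternalDiag (n : ℕ) (D U : Finset ℕ) (δ : ℕ × ℕ) : Prop :=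
  IsDiag n δ ∧ ¬ IsBoundaryEdge n D U δ

/-- Two diagonals cross: the four endpoints are pairwise distinct and exactly one
endpoint of the second lies strictly inside each of the two arcs determined by the first. -/
def Cross (n : ℕ) (D U : Finset ℕ) (δ δ' : ℕ × ℕ) : Prop :=
  δ.1 ≠ δ.2 ∧ δ'.1 ≠ δ'.2 ∧ δ.1 ≠ δ'.1 ∧ δ.1 ≠ δ'.2 ∧ δ.2 ≠ δ'.1 ∧ δ.2 ≠ δ'.2 ∧
  ((StrictBetween n D U δ.1 δ.2 δ'.1 ∧ StrictBetween n D U δ.2 δ.1 δ'.2) ∨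
   (StrictBetween n D U δ.1 δ.2 δ'.2 ∧ StrictBetween n D U δ.2 δ.1 δ'.1))

/-- A triangulation: a maximal set of pairwise non-crossing internal diagonals. -/
def IsTriangulation (n : ℕ) (D U : Finset ℕ) (T : Finset (ℕ × ℕ)) : Prop :=
  (∀ δ ∈ T, IsInternalDiag n D U δ) ∧
  (∀ δ ∈ T, ∀ δ' ∈ T, ¬ Cross n D U δ δ') ∧
  (∀ δ, IsInternalDiag n D U δ → δ ∉ T → ∃ δ' ∈ T, Cross n D U δ δ')

/-- `a` and `b` (with `a < b`) are joined by a diagonal of `T` or a boundary edge. -/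
def EdgeOf (n : ℕ) (D U : Finset ℕ) (T : Finset (ℕ × ℕ)) (a b : ℕ) : Prop :=
  (a, b) ∈ T ∨ IsBoundaryEdge n D U (a, b)

/-- `{i,j,k}` with `i<j<k` is a triangle of the triangulation `T`. -/
def IsTriangleOf (n : ℕ) (D U : Finset ℕ) (T : Finset (ℕ × ℕ)) (i j k : ℕ) : Prop :=
  i < j ∧ j < k ∧ k ≤ n + 2 ∧
    EdgeOf n D U T i j ∧ EdgeOf n D U T j k ∧ EdgeOf n D U T i k

/-- `Bel δ`: labels in `[n+1]` strictly inside the ccw arc from `δ.1` to `δ.2`,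
together with the endpoints of `δ` lying in `U`. -/
def Bel (n : ℕ) (D U : Finset ℕ) (δ : ℕ × ℕ) : Finset ℕ :=
  (Finset.Icc 1 (n + 1)).filter
    (fun j => StrictBetween n D U δ.1 δ.2 j ∨ (j ∈ U ∧ (j = δ.1 ∨ j = δ.2)))

def bel (n : ℕ) (D U : Finset ℕ) (δ : ℕ × ℕ) : ℕ := (Bel n D U δ).card

def Abo (n : ℕ) (D U : Finset ℕ) (δ : ℕ × ℕ) : Finset ℕ :=
  Finset.Icc 1 (n + 1) \ Bel n D U δ

/-- The coordinates of the point `x(T)` associated to a triangulation `T`. -/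
def xcoord (n : ℕ) (D U : Finset ℕ) (T : Finset (ℕ × ℕ)) (j : ℕ) : ℝ :=
  if h : ∃ p : ℕ × ℕ, IsTriangleOf n D U T p.1 j p.2 then
    if j ∈ D then
      ((bel n D U (h.choose.1, j) : ℝ) + 1) * ((bel n D U (j, h.choose.2) : ℝ) + 1)
    else
      ((n : ℝ) + 2) -
        (((n : ℝ) + 2) - (bel n D U (h.choose.1, j) : ℝ)) *
          (((n : ℝ) + 2) - (bel n D U (j, h.choose.2) : ℝ))
  else 0

/-- Middle vertex of the triple `{a,b,c}` with `a < b` and `c ∉ {a,b}`. -/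
def midOf (a b c : ℕ) : ℕ := if c < a then a else if c < b then c else b

/-- `c` is the third vertex of a triangle of `T` containing the diagonal `δ`. -/
def TriWith (n : ℕ) (D U : Finset ℕ) (T : Finset (ℕ × ℕ)) (δ : ℕ × ℕ) (c : ℕ) : Prop :=
  if c < δ.1 then IsTriangleOf n D U T c δ.1 δ.2
  else if c < δ.2 then IsTriangleOf n D U T δ.1 c δ.2
  else IsTriangleOf n D U T δ.1 δ.2 c

/-- `s_δ`: middle vertex of the triangle of `T` below `δ` (third vertex strictly
inside the ccw arc from `δ.1` to `δ.2`). -/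
def spineSrc (n : ℕ) (D U : Finset ℕ) (T : Finset (ℕ × ℕ)) (δ : ℕ × ℕ) : ℕ :=
  if h : ∃ c, StrictBetween n D U δ.1 δ.2 c ∧ TriWith n D U T δ c then
    midOf δ.1 δ.2 h.choose
  else 0

/-- `t_δ`: middle vertex of the triangle of `T` above `δ` (third vertex strictly
inside the ccw arc from `δ.2` to `δ.1`). -/
def spineTgt (n : ℕ) (D U : Finset ℕ) (T : Finset (ℕ × ℕ)) (δ : ℕ × ℕ) : ℕ :=
  if h : ∃ c, StrictBetween n D U δ.2 δ.1 c ∧ TriWith n D U T δ c then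
    midOf δ.1 δ.2 h.choose
  else 0

/-- `(p,q)` is an arc of the spine of `T`. -/
def SpineArc (n : ℕ) (D U : Finset ℕ) (T : Finset (ℕ × ℕ)) (p q : ℕ) : Prop :=
  ∃ δ ∈ T, spineSrc n D U T δ = p ∧ spineTgt n D U T δ = q

/-- The finite set of all triangulations of the polygon. -/
def allTri (n : ℕ) (D U : Finset ℕ) : Finset (Finset (ℕ × ℕ)) :=
  ((Finset.range (n + 3) ×ˢ Finset.range (n + 3)).filter
      (fun δ => IsInternalDiag n D U δ)).powerset.filter
    (fun T => IsTriangulation n D U T)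

end Spines

namespace Spines

/-- Number of triangulations of `P` whose spine has exactly `ℓ` ordered arcs
(arcs `(s_δ, t_δ)` with `s_δ < t_δ`). -/
def orderedArcCount (n : ℕ) (D U : Finset ℕ) (ℓ : ℕ) : ℕ :=
  ((allTri n D U).filter
    (fun T => (T.filter (fun δ => spineSrc n D U T δ < spineTgt n D U T δ)).card = ℓ)).card

/-- `v ≤ N` lies strictly inside the arc from `a` to `b`, where the vertices are placed on a
circle at the positions given by `P`. -/
def Btw (N : ℕ) (P : ℕ → ℕ) (a b v : ℕ) : Prop :=
  v ≤ N ∧ (P a < P v ∧ P v < P b ∨ P v < P b ∧ P b < P a ∨ P b < P a ∧ P a < P v)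

/-- The chords `ab` and `cd` cross. -/
def Crs (N : ℕ) (P : ℕ → ℕ) (a b c d : ℕ) : Prop :=
  Btw N P a b c ∧ Btw N P b a d ∨ Btw N P a b d ∧ Btw N P b a c

/-- Length of the arc from `a` to `v`. -/
def arcLength (N : ℕ) (P : ℕ → ℕ) (a v : ℕ) : ℕ :=
  if P a ≤ P v then P v - P a else P v + (N + 1) - P a

/-- `P` lists the vertices outside `U` increasingly, then those of `U` decreasingly. -/
structure Placement (N : ℕ) (P : ℕ → ℕ) (U : Finset ℕ) : Prop where
  lt_of_notMem : ∀ u v, u ∉ U → v ∉ U → u < v → v ≤ N → P u < P v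
  lt_of_mem : ∀ u v, u ∈ U → v ∈ U → u < v → P v < P u
  lt_of_notMem_of_mem : ∀ u v, u ∉ U → v ∈ U → u ≤ N → P u < P v
  pos_le : ∀ v, v ≤ N → P v ≤ N

/-- The chord `ab` belongs to `T` or is a boundary edge. -/
def Joined (N : ℕ) (P : ℕ → ℕ) (T : Finset (ℕ × ℕ)) (a b : ℕ) : Prop :=
  a ≤ N ∧ b ≤ N ∧ a ≠ b ∧
    ((a, b) ∈ T ∨ (b, a) ∈ T ∨ (∀ v, ¬ Btw N P a b v) ∨ ∀ v, ¬ Btw N P b a v)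

/-- `ab` is an internal diagonal. -/
def Internal (N : ℕ) (P : ℕ → ℕ) (a b : ℕ) : Prop :=
  a < b ∧ b ≤ N ∧ (∃ v, Btw N P a b v) ∧ ∃ v, Btw N P b a v

/-- Pairwise noncrossing sets of internal diagonals. -/
structure Dissection (N : ℕ) (P : ℕ → ℕ) (T : Finset (ℕ × ℕ)) : Prop where
  internal : ∀ δ ∈ T, Internal N P δ.1 δ.2
  noncrossing : ∀ δ ∈ T, ∀ δ' ∈ T, ¬ Crs N P δ.1 δ.2 δ'.1 δ'.2

/-- Maximal dissections. -/
structure Triangulation (N : ℕ) (P : ℕ → ℕ) (T : Finset (ℕ × ℕ)) : Prop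
    extends Dissection N P T where
  maximal : ∀ a b, Internal N P a b → (a, b) ∉ T → ∃ δ ∈ T, Crs N P a b δ.1 δ.2

section Geometry

variable {N : ℕ} {P : ℕ → ℕ} {U : Finset ℕ} {T : Finset (ℕ × ℕ)}

theorem Placement.inj (hP : Placement N P U) {u v : ℕ} (hu : u ≤ N) (hv : v ≤ N)
    (h : P u = P v) : u = v := by
  obtain ⟨h1, h2, h3, -⟩ := hP
  have a1 := h1 u v
  have a2 := h1 v u
  have a3 := h2 u v
  have a4 := h2 v u
  have a5 := h3 u v
  have a6 := h3 v u
  by_cases hu' : u ∈ U <;> by_cases hv' : v ∈ U <;> simp only [hu', hv', true_imp_iff, not_true,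
    not_false_iff, false_imp_iff] at * <;> omega

theorem Crs.symm {a b c d : ℕ} (ha : a ≤ N) (hb : b ≤ N) (h : Crs N P a b c d) :
    Crs N P c d a b := by
  unfold Crs Btw at *; omega

theorem Crs.swap {a b c d : ℕ} (h : Crs N P a b c d) : Crs N P a b d c := by
  unfold Crs at *; tauto

theorem Crs.swap_left {a b c d : ℕ} (h : Crs N P a b c d) : Crs N P b a c d := by
  unfold Crs at *; tauto

theorem Joined.symm {a b : ℕ} (h : Joined N P T a b) : Joined N P T b a := by
  unfold Joined at *; tauto

theorem Joined.of_mem {a b : ℕ} (hT : Dissection N P T) (h : (a, b) ∈ T) : Joined N P T a b := by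
  have := hT.internal _ h
  exact ⟨(this.1.trans_le this.2.1).le, this.2.1, this.1.ne, Or.inl h⟩

theorem Joined.mem_of_lt {a b c d : ℕ} (hT : Dissection N P T) (h : Joined N P T a b)
    (h1 : Btw N P a b c) (h2 : Btw N P b a d) (hab : a < b) : (a, b) ∈ T := by
  obtain ⟨-, -, -, h | h | h | h⟩ := h
  · exact h
  · exact absurd (hT.internal _ h).1 (by simp only; omega)
  · exact absurd h1 (h _)
  · exact absurd h2 (h _)

theorem Joined.not_crs {a b c d : ℕ} (hT : Dissection N P T) (h : Joined N P T a b)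
    (h' : Joined N P T c d) : ¬ Crs N P a b c d := by
  intro hc
  have hc' : Crs N P c d a b := hc.symm h.1 h.2.1
  obtain ⟨-, -, -, h | h | h | h⟩ := h
  rotate_left 2
  · obtain hc | hc := hc <;> exact h _ hc.1
  · obtain hc | hc := hc <;> exact h _ hc.2
  all_goals
    obtain ⟨-, -, -, h' | h' | h' | h'⟩ := h'
    rotate_left 2
    · obtain hc | hc := hc' <;> exact h' _ hc.1
    · obtain hc | hc := hc' <;> exact h' _ hc.2
  · exact hT.noncrossing _ h _ h' hc
  · exact hT.noncrossing _ h _ h' hc.swap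
  · exact hT.noncrossing _ h _ h' hc.swap_left
  · exact hT.noncrossing _ h _ h' hc.swap_left.swap

theorem Triangulation.joined_of_not_crs (hT : Triangulation N P T) {a b : ℕ} (ha : a ≤ N)
    (hb : b ≤ N) (hab : a ≠ b) (h : ∀ c d, Joined N P T c d → ¬ Crs N P a b c d) :
    Joined N P T a b := by
  by_contra hJ
  have hJ' := hJ
  simp only [Joined, not_and, not_or, not_forall, not_not] at hJ'
  obtain ⟨h1, h2, h3, h4⟩ := hJ' ha hb hab
  rcases lt_or_gt_of_ne hab with hlt | hlt
  · obtain ⟨δ, hδ, hc⟩ := hT.maximal a b ⟨hlt, hb, h3, h4⟩ h1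
    exact h _ _ (Joined.of_mem hT.toDissection hδ) hc
  · obtain ⟨δ, hδ, hc⟩ := hT.maximal b a ⟨hlt, ha, h4, h3⟩ h2
    exact h _ _ (Joined.of_mem hT.toDissection hδ) hc.swap_left

theorem Triangulation.exists_apex (hP : Placement N P U) (hT : Triangulation N P T) {a b : ℕ}
    (hJ : Joined N P T a b) (hv : ∃ v, Btw N P a b v) :
    ∃ c, Btw N P a b c ∧ Joined N P T a c ∧ Joined N P T c b := by
  have haN := hJ.1
  have hbN := hJ.2.1
  have hPa := hP.pos_le a haN
  have hPb := hP.pos_le b hbN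
  let F := (Finset.range (N + 1)).filter fun c => Btw N P a b c
  have hF : F.Nonempty := by
    obtain ⟨v, hv⟩ := hv
    exact ⟨v, by simpa [F, hv] using Nat.lt_succ_of_le hv.1⟩
  obtain ⟨v, hvF, hvmin⟩ := F.exists_min_image (arcLength N P a) hF
  have hv : Btw N P a b v := (Finset.mem_filter.1 hvF).2
  have hav : Joined N P T a v := by
    refine ⟨haN, hv.1, by rintro rfl; unfold Btw at hv; omega, Or.inr (Or.inr (Or.inl ?_))⟩
    intro w hw
    have hPv := hP.pos_le v hv.1
    have hPw := hP.pos_le w hw.1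
    have := hvmin w (by
      simp only [F, Finset.mem_filter, Finset.mem_range]
      refine ⟨Nat.lt_succ_of_le hw.1, ?_⟩
      unfold Btw at *; omega)
    unfold arcLength at this
    unfold Btw at *
    split_ifs at this <;> omega
  let G := F.filter fun c => Joined N P T a c
  obtain ⟨c, hcG, hcmax⟩ := G.exists_max_image (arcLength N P a)
    ⟨v, Finset.mem_filter.2 ⟨hvF, hav⟩⟩
  obtain ⟨hcF, hac⟩ := Finset.mem_filter.1 hcG
  have hc : Btw N P a b c := (Finset.mem_filter.1 hcF).2
  refine ⟨c, hc, hac, hT.joined_of_not_crs hc.1 hbN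
    (by rintro rfl; unfold Btw at hc; omega) ?_⟩
  have key : ∀ x y, Joined N P T x y → Btw N P c b x → Btw N P b c y → False := by
    intro x y hxy hx hy
    have h1 := hJ.not_crs hT.toDissection hxy
    have h2 := hac.not_crs hT.toDissection hxy
    by_cases hya : y = a
    · subst hya
      have := hcmax x (by
        simp only [G, F, Finset.mem_filter, Finset.mem_range]
        refine ⟨⟨Nat.lt_succ_of_le hx.1, ?_⟩, hxy.symm⟩
        unfold Btw at *; omega)
      have := hP.pos_le x hx.1
      have := hP.pos_le c hc.1
      unfold arcLength at *
      unfold Btw at *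
      split_ifs at * <;> omega
    · have hne : P y ≠ P a := fun h => hya (hP.inj hy.1 haN h)
      have hx1 : Btw N P a b x := by unfold Btw at *; omega
      have hx2 : Btw N P c a x := by unfold Btw at *; omega
      have hy1 : ¬ Btw N P b a y := fun h => h1 (Or.inl ⟨hx1, h⟩)
      have hy2 : ¬ Btw N P a c y := fun h => h2 (Or.inr ⟨h, hx2⟩)
      clear h1 h2 hx1 hx2 hcmax
      unfold Btw at *
      omega
  rintro x y hxy (⟨h1, h2⟩ | ⟨h1, h2⟩)
  · exact key x y hxy h1 h2
  · exact key y x hxy.symm h1 h2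

theorem Dissection.apex_unique (hP : Placement N P U) (hT : Dissection N P T) {a b c c' : ℕ}
    (ha : a ≤ N) (hb : b ≤ N) (hc : Btw N P a b c) (hac : Joined N P T a c)
    (hcb : Joined N P T c b) (hc' : Btw N P a b c') (hac' : Joined N P T a c')
    (hcb' : Joined N P T c' b) : c = c' := by
  apply hP.inj hc.1 hc'.1
  by_contra hne
  obtain h | h : Btw N P a c c' ∨ Btw N P c b c' := by unfold Btw at *; omega
  · refine hac.not_crs hT hcb' (Or.inl ⟨h, ?_⟩)
    unfold Btw at *; omega
  · refine hcb.not_crs hT hac'.symm (Or.inl ⟨h, ?_⟩)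
    unfold Btw at *; omega

end Geometry

section Slopes

variable {N : ℕ} {P : ℕ → ℕ} {U : Finset ℕ}

theorem Placement.lt_or_lt (hP : Placement N P U) {u v : ℕ} (h : u < v) (hv : v ≤ N) :
    u ∉ U ∧ P u < P v ∨ u ∈ U ∧ P v < P u := by
  by_cases hu : u ∈ U
  · refine Or.inr ⟨hu, ?_⟩
    by_cases hv' : v ∈ U
    · exact hP.lt_of_mem u v hu hv' h
    · exact hP.lt_of_notMem_of_mem v u hv' hu hv
  · refine Or.inl ⟨hu, ?_⟩
    by_cases hv' : v ∈ U
    · exact hP.lt_of_notMem_of_mem u v hu hv' (by omega)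
    · exact hP.lt_of_notMem u v hu hv' h hv

theorem Placement.btw_iff (hP : Placement N P U) {i j k : ℕ} (hij : i < j) (hjk : j < k)
    (hk : k ≤ N) : Btw N P i k j ↔ j ∉ U := by
  have h1 := hP.lt_or_lt hij (by omega)
  have h2 := hP.lt_or_lt hjk hk
  have h3 := hP.lt_or_lt (hij.trans hjk) hk
  unfold Btw
  by_cases hi : i ∈ U <;> by_cases hj : j ∈ U <;>
    simp only [hi, hj, true_and, false_and, or_false, false_or, not_true, not_false_iff, iff_true,
      iff_false] at * <;> omega

theorem Placement.btw_iff' (hP : Placement N P U) {i j k : ℕ} (hij : i < j) (hjk : j < k)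
    (hk : k ≤ N) : Btw N P k i j ↔ j ∈ U := by
  rw [← not_iff_not, ← hP.btw_iff hij hjk hk]
  have h1 : P i ≠ P j := fun h => hij.ne (hP.inj (by omega) (by omega) h)
  have h2 : P k ≠ P j := fun h => hjk.ne' (hP.inj (by omega) (by omega) h)
  have h3 : P k ≠ P i := fun h => (hij.trans hjk).ne' (hP.inj (by omega) (by omega) h)
  unfold Btw
  omega

/-- The vertices outside `U` lie on a convex parabola, those of `U` on its mirror image. -/
def height (N : ℕ) (U : Finset ℕ) (v : ℕ) : ℝ :=
  if v ∈ U then (v : ℝ) * (N - v) else (v : ℝ) * (v - N)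

/-- Slope of the chord `ab` when vertex `v` has coordinates `(v, height v)`. -/
def slope (N : ℕ) (U : Finset ℕ) (a b : ℕ) : ℝ :=
  (height N U b - height N U a) / ((b : ℝ) - a)

theorem slope_comm (a b : ℕ) : slope N U a b = slope N U b a := by
  unfold slope
  rw [← neg_sub (height N U a), ← neg_sub (a : ℝ), neg_div_neg_eq]

theorem le_height {v : ℕ} (hv : v ≤ N) : (v : ℝ) * (v - N) ≤ height N U v := by
  have : (v : ℝ) ≤ N := by exact_mod_cast hv
  have h0 : (0 : ℝ) ≤ v := by positivity
  unfold height
  split_ifs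
  · nlinarith
  · exact le_rfl

theorem height_le {v : ℕ} (hv : v ≤ N) : height N U v ≤ (v : ℝ) * (N - v) := by
  have : (v : ℝ) ≤ N := by exact_mod_cast hv
  have h0 : (0 : ℝ) ≤ v := by positivity
  unfold height
  split_ifs
  · exact le_rfl
  · nlinarith

theorem slope_lt_of_notMem {i j k : ℕ} (hij : i < j) (hjk : j < k) (hk : k ≤ N) (hj : j ∉ U) :
    slope N U i j < slope N U i k ∧ slope N U i k < slope N U j k := by
  have h1 := le_height (U := U) (show i ≤ N by omega)
  have h2 := le_height (U := U) hk
  have h3 : height N U j = (j : ℝ) * (j - N) := if_neg hj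
  have hij' : (0 : ℝ) < j - i := sub_pos.2 (by exact_mod_cast hij)
  have hjk' : (0 : ℝ) < k - j := sub_pos.2 (by exact_mod_cast hjk)
  have hik' : (0 : ℝ) < k - i := by linarith
  have e1 := mul_le_mul_of_nonneg_right h1 hjk'.le
  have e2 := mul_le_mul_of_nonneg_right h2 hij'.le
  have e3 : 0 < ((j : ℝ) - i) * (k - j) * (k - i) := by positivity
  unfold slope
  rw [h3, div_lt_div_iff₀ hij' hik', div_lt_div_iff₀ hik' hjk']
  constructor <;> nlinarith

theorem slope_lt_of_mem {i j k : ℕ} (hij : i < j) (hjk : j < k) (hk : k ≤ N) (hj : j ∈ U) :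
    slope N U i k < slope N U i j ∧ slope N U j k < slope N U i k := by
  have h1 := height_le (U := U) (show i ≤ N by omega)
  have h2 := height_le (U := U) hk
  have h3 : height N U j = (j : ℝ) * (N - j) := if_pos hj
  have hij' : (0 : ℝ) < j - i := sub_pos.2 (by exact_mod_cast hij)
  have hjk' : (0 : ℝ) < k - j := sub_pos.2 (by exact_mod_cast hjk)
  have hik' : (0 : ℝ) < k - i := by linarith
  have e1 := mul_le_mul_of_nonneg_right h1 hjk'.le
  have e2 := mul_le_mul_of_nonneg_right h2 hij'.le
  have e3 : 0 < ((j : ℝ) - i) * (k - j) * (k - i) := by positivity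
  unfold slope
  rw [h3, div_lt_div_iff₀ hik' hij', div_lt_div_iff₀ hjk' hik']
  constructor <;> nlinarith

theorem Placement.midOf_mono (hP : Placement N P U) {p q e e' : ℕ} (hpq : p < q) (hq : q ≤ N)
    (he : Btw N P p q e) (he' : Btw N P e q e') : midOf p q e ≤ midOf p q e' := by
  by_contra! hlt
  have heN := he.1
  have heN' := he'.1
  have hne : P e ≠ P e' := by unfold Btw at he'; omega
  have hne' : e ≠ e' := fun h => hne (h ▸ rfl)
  have a : e' < e ∧ p < e ∧ e' < q := by unfold midOf at hlt; split_ifs at hlt <;> omega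
  have h1 := hP.lt_or_lt a.1 heN
  have h2 := hP.lt_or_lt hpq hq
  have h3 := hP.lt_or_lt a.2.1 heN
  have h4 := hP.lt_or_lt a.2.2 hq
  rcases lt_trichotomy p e' with h | rfl | h
  · have h5 := hP.lt_or_lt h heN'
    rcases lt_trichotomy e q with h' | rfl | h'
    · have h6 := hP.lt_or_lt h' hq
      unfold Btw at *
      by_cases p ∈ U <;> by_cases e ∈ U <;> by_cases e' ∈ U <;> simp_all <;> omega
    · unfold Btw at *
      omega
    · have h6 := hP.lt_or_lt h' heN
      unfold Btw at *
      by_cases p ∈ U <;> by_cases q ∈ U <;> by_cases e' ∈ U <;> simp_all <;> omega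
  · unfold Btw at *
    omega
  · have h5 := hP.lt_or_lt h (by omega)
    rcases lt_trichotomy e q with h' | rfl | h'
    · have h6 := hP.lt_or_lt h' hq
      unfold Btw at *
      by_cases p ∈ U <;> by_cases e ∈ U <;> by_cases e' ∈ U <;> simp_all <;> omega
    · unfold Btw at *
      omega
    · have h6 := hP.lt_or_lt h' heN
      unfold Btw at *
      by_cases p ∈ U <;> by_cases q ∈ U <;> by_cases e' ∈ U <;> simp_all <;> omega

theorem Placement.midOf_lt_iff (hP : Placement N P U) {p q e f : ℕ} (hpq : p < q) (hq : q ≤ N)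
    (he : Btw N P p q e) (hf : Btw N P q p f) :
    midOf p q e < midOf p q f ∧ slope N U p q < slope N U e f ∨
      midOf p q f < midOf p q e ∧ slope N U e f < slope N U p q := by
  have heN := he.1
  have hfN := hf.1
  have hep : e ≠ p := by rintro rfl; unfold Btw at he; omega
  have heq : e ≠ q := by rintro rfl; unfold Btw at he; omega
  have hfp : f ≠ p := by rintro rfl; unfold Btw at hf; omega
  have hfq : f ≠ q := by rintro rfl; unfold Btw at hf; omega
  have hef : e ≠ f := by rintro rfl; unfold Btw at he hf; omega
  have he' : Btw N P q e p := by unfold Btw at *; omega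
  have he'' : Btw N P e p q := by unfold Btw at *; omega
  have hf' : Btw N P p f q := by unfold Btw at *; omega
  have hf'' : Btw N P f q p := by unfold Btw at *; omega
  have L {i j k : ℕ} (hij : i < j) (hjk : j < k) (hk : k ≤ N) (h : j ∉ U) :=
    slope_lt_of_notMem hij hjk hk h
  have R {i j k : ℕ} (hij : i < j) (hjk : j < k) (hk : k ≤ N) (h : j ∈ U) :=
    slope_lt_of_mem hij hjk hk h
  have m : ∀ v, v < p → midOf p q v = p := fun v h => by simp [midOf, h]
  have m' : ∀ v, p < v → v < q → midOf p q v = v := fun v h h' => by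
    simp [midOf, h', h.le.not_gt]
  have m'' : ∀ v, q < v → midOf p q v = q := fun v h => by
    simp [midOf, (hpq.trans h).le.not_gt, h.le.not_gt]
  rcases lt_or_gt_of_ne hep with h1 | h1
  · have hpU := (hP.btw_iff' h1 hpq hq).1 he'
    rcases lt_or_gt_of_ne hfp with h2 | h2
    · exact absurd hpU ((hP.btw_iff h2 hpq hq).1 hf'')
    rcases lt_or_gt_of_ne hfq with h3 | h3
    · have hfU := (hP.btw_iff' h2 h3 hq).1 hf
      left
      rw [m _ h1, m' _ h2 h3]
      exact ⟨h2, (R h2 h3 hq hfU).1.trans (R h1 h2 hfN hpU).2⟩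
    · have hqU := (hP.btw_iff hpq h3 hfN).1 hf'
      left
      rw [m _ h1, m'' _ h3]
      exact ⟨hpq, (L hpq h3 hfN hqU).1.trans (R h1 h2 hfN hpU).2⟩
  rcases lt_or_gt_of_ne heq with h2 | h2
  · have heU := (hP.btw_iff h1 h2 hq).1 he
    rw [m' _ h1 h2]
    rcases lt_or_gt_of_ne hfp with h3 | h3
    · have hpU := (hP.btw_iff h3 hpq hq).1 hf''
      right
      rw [m _ h3, slope_comm e f]
      exact ⟨h1, (L h3 h1 heN hpU).2.trans (L h1 h2 hq heU).1⟩
    rcases lt_or_gt_of_ne hfq with h4 | h4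
    · have hfU := (hP.btw_iff' h3 h4 hq).1 hf
      rw [m' _ h3 h4]
      rcases lt_or_gt_of_ne hef with h5 | h5
      · exact Or.inl ⟨h5, (L h1 h2 hq heU).2.trans (R h5 h4 hq hfU).1⟩
      · rw [slope_comm e f]
        exact Or.inr ⟨h5, (L h5 h2 hq heU).1.trans (R h3 h4 hq hfU).2⟩
    · have hqU := (hP.btw_iff hpq h4 hfN).1 hf'
      rw [m'' _ h4]
      exact Or.inl ⟨h2, (L h1 h2 hq heU).2.trans (L h2 h4 hfN hqU).1⟩
  · have hqU := (hP.btw_iff' hpq h2 heN).1 he''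
    rw [m'' _ h2, slope_comm e f]
    rcases lt_or_gt_of_ne hfp with h3 | h3
    · have hpU := (hP.btw_iff h3 hpq hq).1 hf''
      rw [m _ h3]
      exact Or.inr ⟨hpq, (L h3 h1 heN hpU).2.trans (R hpq h2 heN hqU).1⟩
    rcases lt_or_gt_of_ne hfq with h4 | h4
    · have hfU := (hP.btw_iff' h3 h4 hq).1 hf
      rw [m' _ h3 h4]
      exact Or.inr ⟨h4, (R h4 h2 heN hqU).1.trans (R h3 h4 hq hfU).2⟩
    · exact absurd hqU ((hP.btw_iff hpq h4 hfN).1 hf')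

end Slopes

section Extremal

variable {N : ℕ} {P : ℕ → ℕ} {U : Finset ℕ} {T S : Finset (ℕ × ℕ)}

/-- The spine arc of the diagonal `ab` of `T` is ordered. -/
def Ascending (N : ℕ) (P : ℕ → ℕ) (T : Finset (ℕ × ℕ)) (a b : ℕ) : Prop :=
  ∀ c d, Btw N P a b c → Btw N P b a d → Joined N P T a c → Joined N P T c b →
    Joined N P T b d → Joined N P T d a → midOf a b c < midOf a b d

theorem Dissection.mono (hT : Dissection N P T) (h : S ⊆ T) : Dissection N P S :=
  ⟨fun δ hδ => hT.internal δ (h hδ), fun δ hδ δ' hδ' => hT.noncrossing δ (h hδ) δ' (h hδ')⟩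

theorem Dissection.insert (hT : Dissection N P T) {a b : ℕ} (hab : Internal N P a b)
    (h : ∀ δ ∈ T, ¬ Crs N P a b δ.1 δ.2) : Dissection N P (insert (a, b) T) := by
  have hself : ¬ Crs N P a b a b := by unfold Crs Btw; omega
  constructor
  · intro δ hδ
    rcases Finset.mem_insert.1 hδ with rfl | hδ
    · exact hab
    · exact hT.internal δ hδ
  · intro δ hδ δ' hδ'
    rcases Finset.mem_insert.1 hδ with rfl | hδ <;> rcases Finset.mem_insert.1 hδ' with rfl | hδ'
    · exact hself
    · exact h _ hδ'
    · intro hc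
      have := hT.internal _ hδ
      exact h _ hδ (hc.symm (this.1.trans_le this.2.1).le this.2.1)
    · exact hT.noncrossing _ hδ _ hδ'

theorem Dissection.subset_box (hT : Dissection N P T) :
    T ⊆ Finset.range (N + 1) ×ˢ Finset.range (N + 1) := by
  intro δ hδ
  have := hT.internal δ hδ
  simp only [Finset.mem_product, Finset.mem_range]
  unfold Internal at this
  omega

theorem Dissection.eq_of_crs_flip (hP : Placement N P U) (hT : Dissection N P T) {a b c d x y : ℕ}
    (ha : a ≤ N) (hb : b ≤ N) (hc : Btw N P a b c) (hd : Btw N P b a d)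
    (hac : Joined N P T a c) (hcb : Joined N P T c b) (hbd : Joined N P T b d)
    (hda : Joined N P T d a) (hxy : Joined N P T x y) (hx : Btw N P c d x)
    (hy : Btw N P d c y) : x = b ∧ y = a := by
  constructor
  · apply hP.inj hx.1 hb
    by_contra hne
    obtain h | h : Btw N P c b x ∨ Btw N P b d x := by unfold Btw at *; omega
    · refine hcb.not_crs hT hxy (Or.inl ⟨h, ?_⟩)
      unfold Btw at *; omega
    · refine hbd.not_crs hT hxy (Or.inl ⟨h, ?_⟩)
      unfold Btw at *; omega
  · apply hP.inj hy.1 ha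
    by_contra hne
    obtain h | h : Btw N P d a y ∨ Btw N P a c y := by unfold Btw at *; omega
    · refine hda.not_crs hT hxy (Or.inr ⟨h, ?_⟩)
      unfold Btw at *; omega
    · refine hac.not_crs hT hxy (Or.inr ⟨h, ?_⟩)
      unfold Btw at *; omega

theorem exists_triangulation_ascending (hP : Placement N P U) (hS : Dissection N P S) :
    ∃ T, Triangulation N P T ∧ S ⊆ T ∧ ∀ δ ∈ T, δ ∉ S → Ascending N P T δ.1 δ.2 := by
  let F := (Finset.range (N + 1) ×ˢ Finset.range (N + 1)).powerset.filter
    fun R => Dissection N P R ∧ S ⊆ R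
  have hF : ∀ R, R ∈ F ↔ Dissection N P R ∧ S ⊆ R := fun R => by
    simp only [F, Finset.mem_filter, Finset.mem_powerset, and_iff_right_iff_imp]
    exact fun h => h.1.subset_box
  let w : ℕ × ℕ → ℝ := fun δ => Real.exp (-slope N U δ.1 δ.2)
  have hw : ∀ δ, 0 < w δ := fun δ => Real.exp_pos _
  obtain ⟨T, hTF, hmax⟩ := F.exists_max_image (fun R => ∑ δ ∈ R, w δ)
    ⟨S, (hF S).2 ⟨hS, subset_rfl⟩⟩
  obtain ⟨hD, hST⟩ := (hF T).1 hTF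
  have hT : Triangulation N P T := by
    refine ⟨hD, fun a b hab hnot => ?_⟩
    by_contra! hcr
    have := hmax _ ((hF _).2 ⟨hD.insert hab hcr, hST.trans (Finset.subset_insert _ _)⟩)
    rw [Finset.sum_insert hnot] at this
    linarith [hw (a, b)]
  refine ⟨T, hT, hST, ?_⟩
  rintro ⟨a, b⟩ hδ hδS c d hc hd hac hcb hbd hda
  simp only at *
  obtain ⟨hab, hbN, -, -⟩ := hD.internal _ hδ
  simp only at hab hbN
  have haN : a ≤ N := by omega
  obtain h | ⟨-, h⟩ := hP.midOf_lt_iff hab hbN hc hd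
  · exact h.1
  exfalso
  have hcr : Crs N P c d a b := Or.inr ⟨by unfold Btw at *; omega, by unfold Btw at *; omega⟩
  obtain ⟨ε, hε, hεw, hεδ, hεc⟩ : ∃ ε : ℕ × ℕ, Internal N P ε.1 ε.2 ∧ w (a, b) < w ε ∧
      Crs N P ε.1 ε.2 a b ∧
      ∀ x y, Crs N P ε.1 ε.2 x y → Crs N P c d x y := by
    have hcd : c ≠ d := by rintro rfl; unfold Btw at *; omega
    have h1 : Btw N P c d b := by unfold Btw at *; omega
    have h2 : Btw N P d c a := by unfold Btw at *; omega
    rcases lt_or_gt_of_ne hcd with hlt | hlt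
    · refine ⟨(c, d), ⟨hlt, hd.1, ⟨_, h1⟩, ⟨_, h2⟩⟩, ?_, hcr, fun x y hxy => hxy⟩
      exact Real.exp_lt_exp.2 (neg_lt_neg h)
    · refine ⟨(d, c), ⟨hlt, hc.1, ⟨_, h2⟩, ⟨_, h1⟩⟩, ?_, hcr.swap_left,
        fun x y hxy => hxy.swap_left⟩
      rw [slope_comm] at h
      exact Real.exp_lt_exp.2 (neg_lt_neg h)
  have hunique : ∀ ζ ∈ T, Crs N P ε.1 ε.2 ζ.1 ζ.2 → ζ = (a, b) := by
    rintro ⟨x, y⟩ hζ hx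
    have hxy := Joined.of_mem hD hζ
    have hlt : x < y := (hD.internal _ hζ).1
    rcases hεc _ _ hx with ⟨h1, h2⟩ | ⟨h1, h2⟩
    · obtain ⟨rfl, rfl⟩ := hD.eq_of_crs_flip hP haN hbN hc hd hac hcb hbd hda hxy h1 h2
      omega
    · obtain ⟨rfl, rfl⟩ := hD.eq_of_crs_flip hP haN hbN hc hd hac hcb hbd hda hxy.symm h1 h2
      rfl
  have hεT : ε ∉ T.erase (a, b) := fun hmem =>
    hD.noncrossing _ (Finset.mem_of_mem_erase hmem) _ hδ hεδ
  have := hmax (insert ε (T.erase (a, b))) ((hF _).2 ⟨?_, ?_⟩)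
  · rw [Finset.sum_insert hεT, ← Finset.add_sum_erase T w hδ] at this
    linarith
  · refine (hD.mono (Finset.erase_subset _ _)).insert hε fun ζ hζ hcr => ?_
    exact Finset.ne_of_mem_erase hζ (hunique ζ (Finset.mem_of_mem_erase hζ) hcr)
  · intro ζ hζ
    refine Finset.mem_insert_of_mem (Finset.mem_erase.2 ⟨?_, hST hζ⟩)
    rintro rfl
    exact hδS hζ

theorem Triangulation.exists_crs_slope_lt (hP : Placement N P U) (hT : Triangulation N P T)
    {p q : ℕ} (hpq : p < q) (hq : q ≤ N)
    (hasc : ∀ δ ∈ T, Crs N P p q δ.1 δ.2 → Ascending N P T δ.1 δ.2)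
    (hcr : ∃ δ ∈ T, Crs N P p q δ.1 δ.2) :
    ∃ δ ∈ T, Crs N P p q δ.1 δ.2 ∧ slope N U δ.1 δ.2 < slope N U p q := by
  by_contra! hno
  have hD := hT.toDissection
  have hpN : p ≤ N := by omega
  have key : ∀ e f, Btw N P p q e → Btw N P q p f → Joined N P T e f →
      midOf p q e < midOf p q f ∧ e < f ∧ Ascending N P T e f := by
    intro e f he hf hef
    have hcef : Crs N P p q e f := Or.inl ⟨he, hf⟩
    have h1 : Btw N P e f q := by unfold Btw at *; omega
    have h2 : Btw N P f e p := by unfold Btw at *; omega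
    have hlt : midOf p q e < midOf p q f := by
      obtain h | ⟨-, h⟩ := hP.midOf_lt_iff hpq hq he hf
      · exact h.1
      rcases lt_or_gt_of_ne hef.2.2.1 with hlt | hlt
      · exact absurd h (hno _ (hef.mem_of_lt hD h1 h2 hlt) hcef).not_gt
      · rw [slope_comm e f] at h
        exact absurd h (hno _ (hef.symm.mem_of_lt hD h2 h1 hlt) hcef.swap).not_gt
    have hlt' : e < f := by
      by_contra! hle
      refine hlt.not_ge ?_
      unfold midOf
      split_ifs <;> omega
    exact ⟨hlt, hlt', hasc _ (hef.mem_of_lt hD h1 h2 hlt') hcef⟩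
  have hpP := hP.pos_le p hpN
  have hqP := hP.pos_le q hq
  have claim : ∀ m e f g, arcLength N P f e < m → Btw N P p q e → Btw N P q p f →
      Joined N P T e f → Btw N P e f g → Joined N P T e g → Joined N P T g f →
      midOf e f g < midOf p q e := by
    intro m
    induction m with
    | zero => omega
    | succ m ih =>
      intro e f g hm he hf hef hg heg hgf
      obtain ⟨hlt, hef', hA⟩ := key e f he hf hef
      have hpf : Btw N P f e p := by unfold Btw at *; omega
      obtain ⟨h, hh, hfh, hhe⟩ := hT.exists_apex hP hef.symm ⟨p, hpf⟩
      have hstep := hA g h hg hh heg hgf hfh hhe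
      have hPe := hP.pos_le e he.1
      have hPf := hP.pos_le f hf.1
      have hPh := hP.pos_le h hh.1
      by_cases hhp : h = p
      · subst hhp
        refine hstep.trans_le ?_
        unfold midOf at hlt ⊢
        split_ifs at * <;> omega
      have hne : P h ≠ P p := fun h' => hhp (hP.inj hh.1 hpN h')
      obtain h' | h' : Btw N P p e h ∨ Btw N P f p h := by unfold Btw at *; omega
      · have hb : Btw N P p q h := by unfold Btw at *; omega
        have hmono := hP.midOf_mono hpq hq hb (e' := e) (by unfold Btw at *; omega)
        have hhf := (key h f hb hf hfh.symm).2.1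
        have := ih h f e (by unfold arcLength Btw at *; split_ifs at * <;> omega) hb hf hfh.symm
          (by unfold Btw at *; omega) hhe hef
        refine hstep.trans_le (le_trans ?_ (this.le.trans hmono))
        unfold midOf
        split_ifs <;> omega
      · have hb : Btw N P q p h := by unfold Btw at *; omega
        have heh := (key e h he hb hhe.symm).2.1
        have := ih e h f (by unfold arcLength Btw at *; split_ifs at * <;> omega) he hb hhe.symm
          (by unfold Btw at *; omega) hef hfh
        refine hstep.trans_le (le_trans ?_ this.le)
        unfold midOf
        split_ifs <;> omega
  have final : ∀ m e f, arcLength N P e f < m → Btw N P p q e → Btw N P q p f →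
      ¬ Joined N P T e f := by
    intro m
    induction m with
    | zero => omega
    | succ m ih =>
      intro e f hm he hf hef
      obtain ⟨hlt, hef', -⟩ := key e f he hf hef
      have hqf : Btw N P e f q := by unfold Btw at *; omega
      obtain ⟨g, hg, heg, hgf⟩ := hT.exists_apex hP hef ⟨q, hqf⟩
      have hPe := hP.pos_le e he.1
      have hPf := hP.pos_le f hf.1
      have hPg := hP.pos_le g hg.1
      by_cases hgq : g = q
      · subst hgq
        have := claim _ e f g (Nat.lt_succ_self _) he hf hef hg heg hgf
        unfold midOf at this hlt
        split_ifs at * <;> omega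
      have hne : P g ≠ P q := fun h' => hgq (hP.inj hg.1 hq h')
      obtain h' | h' : Btw N P e q g ∨ Btw N P q f g := by unfold Btw at *; omega
      · exact ih g f (by unfold arcLength Btw at *; split_ifs at * <;> omega)
          (by unfold Btw at *; omega) hf hgf
      · exact ih e g (by unfold arcLength Btw at *; split_ifs at * <;> omega) he
          (by unfold Btw at *; omega) heg
  obtain ⟨δ, hδ, hc | hc⟩ := hcr
  · exact final _ _ _ (Nat.lt_succ_self _) hc.1 hc.2 (Joined.of_mem hD hδ)
  · exact final _ _ _ (Nat.lt_succ_self _) hc.1 hc.2 (Joined.of_mem hD hδ).symm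

end Extremal

section Counting

variable {N : ℕ} {P : ℕ → ℕ} {U : Finset ℕ} {T T' S : Finset (ℕ × ℕ)}

theorem Triangulation.subset_of_ascending (hP : Placement N P U) (hT : Triangulation N P T)
    (hT' : Triangulation N P T') (hST' : S ⊆ T')
    (hasc : ∀ δ ∈ T, δ ∉ S → Ascending N P T δ.1 δ.2) {ε : ℕ × ℕ} (hε : ε ∈ T') (hεT : ε ∉ T) :
    ∃ δ ∈ T, δ ∉ T' ∧ slope N U δ.1 δ.2 < slope N U ε.1 ε.2 := by
  have hI := hT'.internal _ hε
  obtain ⟨δ, hδ, hc, hlt⟩ := hT.exists_crs_slope_lt hP hI.1 hI.2.1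
    (fun δ hδ hc => hasc δ hδ fun hδS => hT'.noncrossing _ hε _ (hST' hδS) hc)
    (hT.maximal _ _ hI hεT)
  exact ⟨δ, hδ, fun hδ' => hT'.noncrossing _ hε _ hδ' hc, hlt⟩

theorem Triangulation.eq_of_ascending (hP : Placement N P U) (hT : Triangulation N P T)
    (hST : S ⊆ T) (hT' : Triangulation N P T') (hST' : S ⊆ T')
    (hasc : ∀ δ ∈ T, δ ∉ S → Ascending N P T δ.1 δ.2)
    (hasc' : ∀ δ ∈ T', δ ∉ S → Ascending N P T' δ.1 δ.2) : T = T' := by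
  by_contra hne
  have hF : (symmDiff T T').Nonempty := by
    rw [Finset.nonempty_iff_ne_empty]
    intro h
    exact hne (symmDiff_eq_bot.1 h)
  obtain ⟨ε, hε, hmin⟩ := (symmDiff T T').exists_min_image (fun δ => slope N U δ.1 δ.2) hF
  rcases Finset.mem_symmDiff.1 hε with ⟨h1, h2⟩ | ⟨h1, h2⟩
  · obtain ⟨δ, hδ, hδ', hlt⟩ := hT'.subset_of_ascending hP hT hST hasc' h1 h2
    exact (hmin δ (Finset.mem_symmDiff.2 (Or.inr ⟨hδ, hδ'⟩))).not_gt hlt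
  · obtain ⟨δ, hδ, hδ', hlt⟩ := hT.subset_of_ascending hP hT' hST' hasc h1 h2
    exact (hmin δ (Finset.mem_symmDiff.2 (Or.inl ⟨hδ, hδ'⟩))).not_gt hlt

theorem Placement.image_range (hP : Placement N P U) :
    (Finset.range (N + 1)).image P = Finset.range (N + 1) := by
  apply Finset.eq_of_subset_of_card_le
  · intro x hx
    obtain ⟨v, hv, rfl⟩ := Finset.mem_image.1 hx
    have := hP.pos_le v (Nat.lt_succ_iff.1 (Finset.mem_range.1 hv))
    exact Finset.mem_range.2 (by omega)
  · rw [Finset.card_image_of_injOn]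
    intro u hu v hv h
    simp only [Finset.coe_range, Set.mem_Iio] at hu hv
    exact hP.inj (by omega) (by omega) h

theorem Placement.surj (hP : Placement N P U) {i : ℕ} (hi : i ≤ N) : ∃ v ≤ N, P v = i := by
  have : i ∈ (Finset.range (N + 1)).image P := by
    rw [hP.image_range]; exact Finset.mem_range.2 (by omega)
  obtain ⟨v, hv, rfl⟩ := Finset.mem_image.1 this
  exact ⟨v, Nat.lt_succ_iff.1 (Finset.mem_range.1 hv), rfl⟩

/-- Chords joined in `T`, oriented along the positions and excluding short boundary edges. -/
def bases (N : ℕ) (P : ℕ → ℕ) (T : Finset (ℕ × ℕ)) : Finset (ℕ × ℕ) :=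
  (Finset.range (N + 1) ×ˢ Finset.range (N + 1)).filter
    fun δ => P δ.1 < P δ.2 ∧ Joined N P T δ.1 δ.2 ∧ ∃ v, Btw N P δ.1 δ.2 v

theorem mem_bases {a b : ℕ} :
    (a, b) ∈ bases N P T ↔ P a < P b ∧ Joined N P T a b ∧ ∃ v, Btw N P a b v := by
  simp only [bases, Finset.mem_filter, Finset.mem_product, Finset.mem_range, and_iff_right_iff_imp]
  rintro ⟨-, h, -⟩
  have := h.1
  have := h.2.1
  omega

theorem Triangulation.card_bases (hP : Placement N P U) (hT : Triangulation N P T) (hN : 2 ≤ N) :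
    (bases N P T).card = N - 1 := by
  have hD := hT.toDissection
  have hB : ((Finset.range (N + 1)).filter fun c => 0 < P c ∧ P c < N).card = N - 1 := by
    have : (((Finset.range (N + 1)).filter fun c => 0 < P c ∧ P c < N).image P) =
        Finset.Ioo 0 N := by
      ext i
      simp only [Finset.mem_image, Finset.mem_filter, Finset.mem_range, Finset.mem_Ioo]
      constructor
      · rintro ⟨v, ⟨-, h⟩, rfl⟩
        exact h
      · intro h
        obtain ⟨v, hv, rfl⟩ := hP.surj (i := i) (by omega)
        exact ⟨v, ⟨by omega, h⟩, rfl⟩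
    rw [← Finset.card_image_of_injOn (f := P), this, Nat.card_Ioo]
    · omega
    · intro u hu v hv h
      simp only [Finset.coe_filter, Finset.mem_range, Set.mem_ofPred_eq] at hu hv
      exact hP.inj (by omega) (by omega) h
  rw [← hB]
  have hex : ∀ δ ∈ bases N P T, ∃ c, Btw N P δ.1 δ.2 c ∧ Joined N P T δ.1 c ∧
      Joined N P T c δ.2 := by
    rintro ⟨a, b⟩ hδ
    obtain ⟨-, h1, h2⟩ := mem_bases.1 hδ
    exact hT.exists_apex hP h1 h2
  choose! f hf using hex
  refine Finset.card_bij (fun δ _ => f δ) ?_ ?_ ?_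
  · rintro ⟨a, b⟩ hδ
    obtain ⟨h1, h2, h3⟩ := hf _ hδ
    obtain ⟨h4, h5, h6⟩ := mem_bases.1 hδ
    have := hP.pos_le b h5.2.1
    simp only [Finset.mem_filter, Finset.mem_range]
    simp only at h1
    unfold Btw at h1
    omega
  · rintro ⟨a, b⟩ hδ ⟨a', b'⟩ hδ' heq
    obtain ⟨h1, h2, h3⟩ := hf _ hδ
    obtain ⟨h1', h2', h3'⟩ := hf _ hδ'
    simp only at *
    rw [← heq] at h1' h2' h3'
    generalize f (a, b) = c at *
    obtain ⟨h4, h5, -⟩ := mem_bases.1 hδ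
    obtain ⟨h4', h5', -⟩ := mem_bases.1 hδ'
    have h6 := h5.1
    have h7 := h5.2.1
    have h6' := h5'.1
    have h7' := h5'.2.1
    have ea : P a = P a' := by
      rcases lt_trichotomy (P a) (P a') with h | h | h
      · exact (h2.not_crs hD h5'.symm
          (Or.inr ⟨by unfold Btw at *; omega, by unfold Btw at *; omega⟩)).elim
      · exact h
      · exact (h2'.not_crs hD h5.symm
          (Or.inr ⟨by unfold Btw at *; omega, by unfold Btw at *; omega⟩)).elim
    have eb : P b = P b' := by
      rcases lt_trichotomy (P b) (P b') with h | h | h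
      · exact (h3'.not_crs hD h5.symm
          (Or.inl ⟨by unfold Btw at *; omega, by unfold Btw at *; omega⟩)).elim
      · exact h
      · exact (h3.not_crs hD h5'.symm
          (Or.inl ⟨by unfold Btw at *; omega, by unfold Btw at *; omega⟩)).elim
    rw [hP.inj h5.1 h5'.1 ea, hP.inj h5.2.1 h5'.2.1 eb]
  · intro c hc
    simp only [Finset.mem_filter, Finset.mem_range] at hc
    obtain ⟨z, hz, hz0⟩ := hP.surj (i := 0) (by omega)
    obtain ⟨r, hr, hrN⟩ := hP.surj (i := N) le_rfl
    obtain ⟨⟨a, b⟩, hab, hmin⟩ :=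
      ((bases N P T).filter fun δ => Btw N P δ.1 δ.2 c).exists_min_image (fun δ => P δ.2 - P δ.1)
      ⟨(z, r), by
        have hzr : Btw N P z r c := ⟨by omega, by omega⟩
        refine Finset.mem_filter.2 ⟨mem_bases.2 ⟨by omega, ⟨hz, hr, ?_, ?_⟩, c, hzr⟩, hzr⟩
        · rintro rfl; omega
        · refine Or.inr (Or.inr (Or.inr fun v hv => ?_))
          have := hP.pos_le v hv.1
          unfold Btw at hv
          omega⟩
    obtain ⟨hab, habc⟩ := Finset.mem_filter.1 hab
    obtain ⟨h1, h2, h3⟩ := hf _ hab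
    obtain ⟨h4, -, -⟩ := mem_bases.1 hab
    refine ⟨_, hab, ?_⟩
    simp only at *
    generalize f (a, b) = d at *
    apply hP.inj h1.1 habc.1
    by_contra hne
    obtain h | h : P c < P d ∨ P d < P c := by omega
    · have hadc : Btw N P a d c := by unfold Btw at *; omega
      have := hmin (a, d) (Finset.mem_filter.2
        ⟨mem_bases.2 ⟨by unfold Btw at *; omega, h2, c, hadc⟩, hadc⟩)
      simp only at this
      unfold Btw at *
      omega
    · have hadc : Btw N P d b c := by unfold Btw at *; omega
      have := hmin (d, b) (Finset.mem_filter.2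
        ⟨mem_bases.2 ⟨by unfold Btw at *; omega, h3, c, hadc⟩, hadc⟩)
      simp only at this
      unfold Btw at *
      omega

theorem Triangulation.card_eq (hP : Placement N P U) (hT : Triangulation N P T) (hN : 2 ≤ N) :
    T.card + 2 = N := by
  have hD := hT.toDissection
  obtain ⟨z, hz, hz0⟩ := hP.surj (i := 0) (by omega)
  obtain ⟨r, hr, hrN⟩ := hP.surj (i := N) le_rfl
  obtain ⟨m, hm, hm1⟩ := hP.surj (i := 1) (by omega)
  let o : ℕ × ℕ → ℕ × ℕ := fun δ => if P δ.1 < P δ.2 then δ else δ.swap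
  have ho : ∀ δ ∈ T, Internal N P (o δ).1 (o δ).2 ∨ Internal N P (o δ).2 (o δ).1 := by
    intro δ hδ
    have := hD.internal _ hδ
    simp only [o]
    split_ifs
    · exact Or.inl this
    · exact Or.inr this
  have hA : bases N P T = insert (z, r) (T.image o) := by
    ext ⟨a, b⟩
    rw [mem_bases, Finset.mem_insert, Finset.mem_image]
    constructor
    · rintro ⟨h1, h2, v, hv⟩
      obtain ⟨haN, hbN, -, h | h | h | h⟩ := h2
      · exact Or.inr ⟨_, h, by simp [o, h1]⟩
      · exact Or.inr ⟨_, h, by simp [o, h1.not_gt]⟩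
      · exact absurd hv (h v)
      · left
        have hb := hP.pos_le b hbN
        have ha0 : P a = P z := by
          by_contra hne
          exact h z ⟨hz, by omega⟩
        have hbr : P b = P r := by
          by_contra hne
          exact h r ⟨hr, by omega⟩
        rw [hP.inj haN hz ha0, hP.inj hbN hr hbr]
    · rintro (h | ⟨⟨x, y⟩, hδ, h⟩)
      · obtain ⟨rfl, rfl⟩ := Prod.mk.inj h
        refine ⟨by omega, ⟨hz, hr, by rintro rfl; omega, Or.inr (Or.inr (Or.inr ?_))⟩, m, hm,
          by omega⟩
        intro v hv
        have := hP.pos_le v hv.1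
        unfold Btw at hv
        omega
      · have hI := hD.internal _ hδ
        have hne : P x ≠ P y := fun h =>
          hI.1.ne (hP.inj (hI.1.trans_le hI.2.1).le hI.2.1 h)
        have hJ := Joined.of_mem hD hδ
        simp only [o] at h
        split_ifs at h with hlt
        · obtain ⟨rfl, rfl⟩ := Prod.mk.inj h
          exact ⟨hlt, hJ, hI.2.2.1⟩
        · obtain ⟨rfl, rfl⟩ := Prod.mk.inj h
          exact ⟨by simp only at *; omega, hJ.symm, hI.2.2.2⟩
  have hcard := hT.card_bases hP hN
  rw [hA, Finset.card_insert_of_notMem, Finset.card_image_of_injOn] at hcard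
  · omega
  · intro δ hδ δ' hδ' h
    have h1 := (hD.internal _ hδ).1
    have h2 := (hD.internal _ hδ').1
    simp only [o] at h
    split_ifs at h
    · exact h
    · rw [h] at h1; exact absurd h1 h2.not_gt
    · rw [← h] at h2; exact absurd h1 h2.not_gt
    · exact Prod.swap_injective h
  · intro hmem
    obtain ⟨δ, hδ, h⟩ := Finset.mem_image.1 hmem
    have h' := ho δ hδ
    rw [h] at h'
    obtain ⟨-, -, -, v, hv⟩ | ⟨-, -, ⟨v, hv⟩, -⟩ := h'
    all_goals
      have := hP.pos_le v hv.1
      unfold Btw at hv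
      simp only at hv
      omega

end Counting

section Counting

variable {α : Type*} [DecidableEq α] {𝒯 𝒮 : Finset (Finset α)} {n : ℕ}

/-- If every `S ∈ 𝒮` extends uniquely to some `T ∈ 𝒯` by elements of `A T`, then the generating
polynomial of `#(A T)` is determined by `𝒮`. -/
theorem sum_add_one_pow_card (A : Finset α → Finset α) (hcard : ∀ T ∈ 𝒯, T.card = n)
    (hA : ∀ T, A T ⊆ T) (hsub : ∀ T ∈ 𝒯, ∀ S ⊆ T, S ∈ 𝒮)
    (hex : ∀ S ∈ 𝒮, ∃ T ∈ 𝒯, S ⊆ T ∧ T \ S ⊆ A T)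
    (huniq : ∀ S, ∀ T ∈ 𝒯, ∀ T' ∈ 𝒯, S ⊆ T → S ⊆ T' → T \ S ⊆ A T → T' \ S ⊆ A T' → T = T')
    (x : ℤ) : ∑ T ∈ 𝒯, (x + 1) ^ (A T).card = ∑ S ∈ 𝒮, x ^ (n - S.card) := by
  have h : ∀ T ∈ 𝒯, (x + 1) ^ (A T).card = ∑ B ∈ (A T).powerset, x ^ B.card := fun T _ => by
    simpa using (Finset.sum_pow_mul_eq_add_pow x 1 (A T)).symm
  rw [Finset.sum_congr rfl h, Finset.sum_sigma']
  refine Finset.sum_bij (fun p _ => p.1 \ p.2) ?_ ?_ ?_ ?_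
  · rintro ⟨T, B⟩ hp
    exact hsub T (Finset.mem_sigma.1 hp).1 _ Finset.sdiff_subset
  · rintro ⟨T, B⟩ hp ⟨T', B'⟩ hp' heq
    simp only [Finset.mem_sigma, Finset.mem_powerset] at hp hp' heq
    have hB : T \ (T \ B) = B := sdiff_sdiff_eq_self (hp.2.trans (hA T))
    have hB' : T' \ (T' \ B') = B' := sdiff_sdiff_eq_self (hp'.2.trans (hA T'))
    obtain rfl : T = T' := huniq (T \ B) T hp.1 T' hp'.1 Finset.sdiff_subset
      (heq ▸ Finset.sdiff_subset) (hB.symm ▸ hp.2) (by rw [heq, hB']; exact hp'.2)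
    rw [← hB, heq, hB']
  · intro S hS
    obtain ⟨T, hT, hST, hTS⟩ := hex S hS
    exact ⟨⟨T, T \ S⟩, Finset.mem_sigma.2 ⟨hT, Finset.mem_powerset.2 hTS⟩,
      sdiff_sdiff_eq_self hST⟩
  · rintro ⟨T, B⟩ hp
    simp only [Finset.mem_sigma, Finset.mem_powerset] at hp
    have hBT := hp.2.trans (hA T)
    have := Finset.card_le_card hBT
    dsimp only at *
    rw [Finset.card_sdiff_of_subset hBT, hcard T hp.1] at *
    congr 1
    omega

/-- Statistics with the same generating polynomial are equidistributed. -/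
theorem card_filter_eq_of_sum_pow_eq {ι : Type*} {s : Finset ι} {f g : ι → ℕ}
    (h : ∀ x : ℤ, ∑ i ∈ s, (x + 1) ^ f i = ∑ i ∈ s, (x + 1) ^ g i) (ℓ : ℕ) :
    (s.filter fun i => f i = ℓ).card = (s.filter fun i => g i = ℓ).card := by
  have hpoly : ∑ i ∈ s, (Polynomial.X : Polynomial ℤ) ^ f i = ∑ i ∈ s, Polynomial.X ^ g i := by
    refine Polynomial.funext fun x => ?_
    simpa [Polynomial.eval_finsetSum] using h (x - 1)
  have hcoeff := congrArg (fun p => Polynomial.coeff p ℓ) hpoly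
  simp only [Polynomial.finsetSum_coeff, Polynomial.coeff_X_pow, Finset.sum_boole] at hcoeff
  simpa only [eq_comm, Nat.cast_inj] using hcoeff

end Counting

section Reversal

variable {N : ℕ} {P P' : ℕ → ℕ} {U U' : Finset ℕ} {T S : Finset (ℕ × ℕ)}

/-- `P'` lists the vertices in the opposite cyclic order. -/
def Reversed (N : ℕ) (P P' : ℕ → ℕ) : Prop :=
  ∀ a b v, a ≤ N → b ≤ N → (Btw N P' a b v ↔ Btw N P b a v)

theorem Reversed.crs_iff (h : Reversed N P P') {a b c d : ℕ} (ha : a ≤ N) (hb : b ≤ N) :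
    Crs N P' a b c d ↔ Crs N P a b c d := by
  unfold Crs
  rw [h a b c ha hb, h b a d hb ha, h a b d ha hb, h b a c hb ha]
  tauto

theorem Reversed.internal_iff (h : Reversed N P P') {a b : ℕ} :
    Internal N P' a b ↔ Internal N P a b := by
  unfold Internal
  refine and_congr_right fun h1 => and_congr_right fun h2 => ?_
  simp only [h a b _ (h1.trans_le h2).le h2, h b a _ h2 (h1.trans_le h2).le]
  exact and_comm

theorem Reversed.joined_iff (h : Reversed N P P') {a b : ℕ} :
    Joined N P' T a b ↔ Joined N P T a b := by
  unfold Joined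
  refine and_congr_right fun h1 => and_congr_right fun h2 => ?_
  simp only [h a b _ h1 h2, h b a _ h2 h1]
  tauto

theorem Reversed.dissection_iff (h : Reversed N P P') :
    Dissection N P' T ↔ Dissection N P T := by
  constructor
  all_goals
    rintro ⟨h1, h2⟩
    refine ⟨fun δ hδ => ?_, fun δ hδ δ' hδ' => ?_⟩
    · simpa only [h.internal_iff] using h1 δ hδ
    · have h3 : δ.1 < δ.2 ∧ δ.2 ≤ N := ⟨(h1 δ hδ).1, (h1 δ hδ).2.1⟩
      have := h2 δ hδ δ' hδ'
      rwa [h.crs_iff (by omega) (by omega)] at *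

theorem Reversed.triangulation_iff (h : Reversed N P P') :
    Triangulation N P' T ↔ Triangulation N P T := by
  have hmax : (∀ a b, Internal N P' a b → (a, b) ∉ T → ∃ δ ∈ T, Crs N P' a b δ.1 δ.2) ↔
      ∀ a b, Internal N P a b → (a, b) ∉ T → ∃ δ ∈ T, Crs N P a b δ.1 δ.2 := by
    refine forall₂_congr fun a b => ?_
    rw [h.internal_iff]
    refine imp_congr_right fun hI => ?_
    simp only [h.crs_iff (hI.1.trans_le hI.2.1).le hI.2.1]
  exact ⟨fun hT => ⟨h.dissection_iff.1 hT.toDissection, hmax.1 hT.maximal⟩,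
    fun hT => ⟨h.dissection_iff.2 hT.toDissection, hmax.2 hT.maximal⟩⟩

theorem Triangulation.exists_apexes (hP : Placement N P U) (hT : Triangulation N P T) {a b : ℕ}
    (hab : (a, b) ∈ T) : ∃ c d, Btw N P a b c ∧ Btw N P b a d ∧ Joined N P T a c ∧
      Joined N P T c b ∧ Joined N P T b d ∧ Joined N P T d a := by
  have hI := hT.internal _ hab
  have hJ := Joined.of_mem hT.toDissection hab
  obtain ⟨c, hc, hac, hcb⟩ := hT.exists_apex hP hJ hI.2.2.1
  obtain ⟨d, hd, hbd, hda⟩ := hT.exists_apex hP hJ.symm hI.2.2.2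
  exact ⟨c, d, hc, hd, hac, hcb, hbd, hda⟩

theorem Triangulation.ascending_iff (hP : Placement N P U) (hT : Triangulation N P T)
    {a b c d : ℕ} (ha : a ≤ N) (hb : b ≤ N) (hc : Btw N P a b c) (hd : Btw N P b a d)
    (hac : Joined N P T a c) (hcb : Joined N P T c b) (hbd : Joined N P T b d)
    (hda : Joined N P T d a) : Ascending N P T a b ↔ midOf a b c < midOf a b d := by
  refine ⟨fun h => h c d hc hd hac hcb hbd hda, fun h c' d' hc' hd' hac' hcb' hbd' hda' => ?_⟩
  rw [hT.toDissection.apex_unique hP ha hb hc' hac' hcb' hc hac hcb,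
    hT.toDissection.apex_unique hP hb ha hd' hbd' hda' hd hbd hda]
  exact h

theorem Reversed.ascending_iff (h : Reversed N P P') (hP : Placement N P U)
    (hP' : Placement N P' U') (hT : Triangulation N P T) {a b : ℕ} (hab : (a, b) ∈ T) :
    Ascending N P' T a b ↔ ¬ Ascending N P T a b := by
  have hI := hT.internal _ hab
  have hb : b ≤ N := hI.2.1
  have ha : a ≤ N := (hI.1.trans_le hb).le
  obtain ⟨c, d, hc, hd, hac, hcb, hbd, hda⟩ := hT.exists_apexes hP hab
  rw [hT.ascending_iff hP ha hb hc hd hac hcb hbd hda,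
    (h.triangulation_iff.2 hT).ascending_iff hP' ha hb ((h a b d ha hb).2 hd)
      ((h b a c hb ha).2 hc) (h.joined_iff.2 hda.symm) (h.joined_iff.2 hbd.symm)
      (h.joined_iff.2 hcb.symm) (h.joined_iff.2 hac.symm)]
  have := hP.midOf_lt_iff hI.1 hb hc hd
  dsimp only at this
  omega

/-- Ordered and unordered spine arcs are equidistributed over triangulations. -/
theorem Reversed.card_filter_ascending (h : Reversed N P P') (hP : Placement N P U)
    (hP' : Placement N P' U') (hN : 2 ≤ N) {𝒯 : Finset (Finset (ℕ × ℕ))}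
    (h𝒯 : ∀ T, T ∈ 𝒯 ↔ Triangulation N P T) {ℓ : ℕ} (hℓ : ℓ + 2 ≤ N) :
    (𝒯.filter fun T => (T.filter fun δ => Ascending N P T δ.1 δ.2).card = ℓ).card =
      (𝒯.filter fun T => (T.filter fun δ => Ascending N P T δ.1 δ.2).card = N - 2 - ℓ).card := by
  let 𝒮 := (Finset.range (N + 1) ×ˢ Finset.range (N + 1)).powerset.filter fun R => Dissection N P R
  have h𝒮 : ∀ R, R ∈ 𝒮 ↔ Dissection N P R := fun R => by
    simp only [𝒮, Finset.mem_filter, Finset.mem_powerset, and_iff_right_iff_imp]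
    exact Dissection.subset_box
  have hcard : ∀ T ∈ 𝒯, T.card = N - 2 := fun T hT => by
    have := ((h𝒯 T).1 hT).card_eq hP hN
    omega
  have key : ∀ (Q : ℕ → ℕ) (V : Finset ℕ), Placement N Q V →
      (∀ T, T ∈ 𝒯 ↔ Triangulation N Q T) → (∀ R, R ∈ 𝒮 ↔ Dissection N Q R) → ∀ x : ℤ,
      ∑ T ∈ 𝒯, (x + 1) ^ (T.filter fun δ => Ascending N Q T δ.1 δ.2).card =
        ∑ S ∈ 𝒮, x ^ (N - 2 - S.card) := by
    intro Q V hQ hQ𝒯 hQ𝒮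
    have hmem : ∀ T S : Finset (ℕ × ℕ), T \ S ⊆ T.filter (fun δ => Ascending N Q T δ.1 δ.2) ↔
        ∀ δ ∈ T, δ ∉ S → Ascending N Q T δ.1 δ.2 := fun T S => by
      simp only [Finset.subset_iff, Finset.mem_sdiff, Finset.mem_filter, and_imp]
      exact forall_congr' fun δ => ⟨fun h hT hS => (h hT hS).2, fun h hT hS => ⟨hT, h hT hS⟩⟩
    refine sum_add_one_pow_card (fun T => T.filter fun δ => Ascending N Q T δ.1 δ.2) hcard
      (fun T => Finset.filter_subset _ _) ?_ ?_ ?_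
    · intro T hT S hS
      exact (hQ𝒮 S).2 (((hQ𝒯 T).1 hT).toDissection.mono hS)
    · intro S hS
      obtain ⟨T, hT, hST, hasc⟩ := exists_triangulation_ascending hQ ((hQ𝒮 S).1 hS)
      exact ⟨T, (hQ𝒯 T).2 hT, hST, (hmem T S).2 hasc⟩
    · intro S T hT T' hT' hST hST' hasc hasc'
      exact ((hQ𝒯 T).1 hT).eq_of_ascending hQ hST ((hQ𝒯 T').1 hT') hST' ((hmem T S).1 hasc)
        ((hmem T' S).1 hasc')
  have hcompl : ∀ T ∈ 𝒯, (T.filter fun δ => Ascending N P T δ.1 δ.2).card +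
      (T.filter fun δ => Ascending N P' T δ.1 δ.2).card = N - 2 := by
    intro T hT
    rw [← hcard T hT, ← Finset.card_filter_add_card_filter_not
      (s := T) fun δ : ℕ × ℕ => Ascending N P T δ.1 δ.2]
    congr 2
    exact Finset.filter_congr fun δ hδ => h.ascending_iff hP hP' ((h𝒯 T).1 hT) hδ
  have hsum := card_filter_eq_of_sum_pow_eq (s := 𝒯) (fun x => (key P U hP h𝒯 h𝒮 x).trans
    (key P' U' hP' (fun T => (h𝒯 T).trans h.triangulation_iff.symm)
      (fun R => (h𝒮 R).trans h.dissection_iff.symm) x).symm) ℓ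
  rw [hsum]
  congr 1
  refine Finset.filter_congr fun T hT => ?_
  have := hcompl T hT
  omega

end Reversal

section Bridge

variable {n : ℕ} {D U : Finset ℕ} {T : Finset (ℕ × ℕ)}

theorem pos_of_mem_left (hUD : D ∪ U = Finset.Icc 1 (n + 1)) {v : ℕ} (hv : v ∈ D) :
    pos n D U v = 1 + (D.filter (fun d => d < v)).card := by
  have : v ∈ Finset.Icc 1 (n + 1) := hUD ▸ Finset.mem_union_left _ hv
  rw [Finset.mem_Icc] at this
  rw [pos, if_neg (by omega), if_neg (by omega), if_pos hv]

theorem pos_of_mem_right (hUD : D ∪ U = Finset.Icc 1 (n + 1)) (hdisj : Disjoint D U) {v : ℕ}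
    (hv : v ∈ U) : pos n D U v = D.card + 2 + (U.filter (fun u => v < u)).card := by
  have : v ∈ Finset.Icc 1 (n + 1) := hUD ▸ Finset.mem_union_right _ hv
  rw [Finset.mem_Icc] at this
  rw [pos, if_neg (by omega), if_neg (by omega), if_neg (Finset.disjoint_right.1 hdisj hv)]

theorem eq_zero_or_mem (hUD : D ∪ U = Finset.Icc 1 (n + 1)) {v : ℕ} (hv : v ≤ n + 2) :
    v = 0 ∨ v = n + 2 ∨ v ∈ D ∨ v ∈ U := by
  rw [← Finset.mem_union, hUD, Finset.mem_Icc]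
  omega

theorem card_add_card (hUD : D ∪ U = Finset.Icc 1 (n + 1)) (hdisj : Disjoint D U) :
    D.card + U.card = n + 1 := by
  rw [← Finset.card_union_of_disjoint hdisj, hUD, Nat.card_Icc]
  omega

theorem card_filter_lt_add_card_filter_gt {s : Finset ℕ} {v : ℕ} (hv : v ∈ s) :
    (s.filter (fun d => d < v)).card + (s.filter (fun d => v < d)).card + 1 = s.card := by
  rw [← Finset.card_filter_add_card_filter_not (s := s) fun d => d < v, add_assoc,
    ← Finset.card_insert_of_notMem (a := v) (s := s.filter fun d => v < d) (by simp)]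
  congr 2
  ext d
  simp only [Finset.mem_insert, Finset.mem_filter, not_lt]
  constructor
  · rintro (rfl | ⟨h, h'⟩)
    · exact ⟨hv, le_rfl⟩
    · exact ⟨h, h'.le⟩
  · rintro ⟨h, h'⟩
    rcases h'.eq_or_lt with h' | h'
    · exact Or.inl h'.symm
    · exact Or.inr ⟨h, h'⟩

@[simp] theorem pos_zero : pos n D U 0 = 0 := by simp [pos]

@[simp] theorem pos_last : pos n D U (n + 2) = D.card + 1 := by simp [pos]

theorem pos_add_pos (hUD : D ∪ U = Finset.Icc 1 (n + 1)) (hdisj : Disjoint D U) {v : ℕ}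
    (hv : v ≤ n + 2) (hv0 : v ≠ 0) : pos n D U v + pos n U D v = n + 3 := by
  have hc := card_add_card hUD hdisj
  have hUD' : U ∪ D = Finset.Icc 1 (n + 1) := by rwa [Finset.union_comm]
  rcases eq_zero_or_mem hUD hv with rfl | rfl | h | h
  · exact absurd rfl hv0
  · rw [pos_last, pos_last]; omega
  · rw [pos_of_mem_left hUD h, pos_of_mem_right hUD' hdisj.symm h]
    have := card_filter_lt_add_card_filter_gt h
    omega
  · rw [pos_of_mem_left hUD' h, pos_of_mem_right hUD hdisj h]
    have := card_filter_lt_add_card_filter_gt h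
    omega

theorem pos_pos {v : ℕ} (hv : v ≠ 0) :
    0 < pos n D U v := by
  rw [pos, if_neg hv]
  split_ifs <;> omega

theorem placement_pos (hUD : D ∪ U = Finset.Icc 1 (n + 1)) (hdisj : Disjoint D U) :
    Placement (n + 2) (pos n D U) U := by
  have hmono : ∀ {u v : ℕ}, u ∈ D → u < v →
      (D.filter (fun d => d < u)).card + 1 ≤ (D.filter (fun d => d < v)).card := by
    intro u v hu huv
    refine Finset.card_lt_card (Finset.ssubset_iff_subset_ne.2 ⟨fun w hw => ?_, fun h => ?_⟩)
    · simp only [Finset.mem_filter] at *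
      exact ⟨hw.1, hw.2.trans huv⟩
    · have : u ∈ D.filter (fun d => d < u) := h ▸ Finset.mem_filter.2 ⟨hu, huv⟩
      simp at this
  have hle : ∀ {u : ℕ}, u ∉ U → u ≤ n + 2 → pos n D U u ≤ D.card + 1 := by
    intro u hu huN
    rcases eq_zero_or_mem hUD huN with rfl | rfl | h | h
    · simp
    · simp
    · rw [pos_of_mem_left hUD h]
      have := Finset.card_filter_le D fun d => d < u
      omega
    · exact absurd h hu
  refine ⟨?_, ?_, ?_, ?_⟩
  · intro u v hu hv huv hvN
    rcases eq_zero_or_mem hUD (huv.le.trans hvN) with rfl | rfl | hu' | hu'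
    · rw [pos_zero]
      exact pos_pos (by omega)
    · omega
    · rw [pos_of_mem_left hUD hu']
      rcases eq_zero_or_mem hUD hvN with rfl | rfl | hv' | hv'
      · omega
      · rw [pos_last]
        have := hmono hu' huv
        have := Finset.card_filter_le D fun d => d < n + 2
        omega
      · rw [pos_of_mem_left hUD hv']
        have := hmono hu' huv
        omega
      · exact absurd hv' hv
    · exact absurd hu' hu
  · intro u v hu hv huv
    rw [pos_of_mem_right hUD hdisj hu, pos_of_mem_right hUD hdisj hv]
    have h1 := card_filter_lt_add_card_filter_gt hu
    have h2 := card_filter_lt_add_card_filter_gt hv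
    have h3 : (U.filter (fun d => d < u)).card + 1 ≤ (U.filter (fun d => d < v)).card := by
      refine Finset.card_lt_card (Finset.ssubset_iff_subset_ne.2 ⟨fun w hw => ?_, fun h => ?_⟩)
      · simp only [Finset.mem_filter] at *
        exact ⟨hw.1, hw.2.trans huv⟩
      · have : u ∈ U.filter (fun d => d < u) := h ▸ Finset.mem_filter.2 ⟨hu, huv⟩
        simp at this
    omega
  · intro u v hu hv huN
    rw [pos_of_mem_right hUD hdisj hv]
    have := hle hu huN
    omega
  · intro v hv
    rcases eq_or_ne v 0 with rfl | hv0
    · simp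
    · have := pos_add_pos hUD hdisj hv hv0
      have := pos_pos (n := n) (D := U) (U := D) hv0
      omega

theorem reversed_pos (hUD : D ∪ U = Finset.Icc 1 (n + 1)) (hdisj : Disjoint D U) :
    Reversed (n + 2) (pos n D U) (pos n U D) := by
  have key : ∀ v, v ≤ n + 2 → pos n D U v = 0 ∧ pos n U D v = 0 ∨
      0 < pos n D U v ∧ 0 < pos n U D v ∧ pos n D U v + pos n U D v = n + 3 := by
    intro v hv
    rcases eq_or_ne v 0 with rfl | hv0
    · simp
    · exact Or.inr ⟨pos_pos hv0, pos_pos hv0,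
        pos_add_pos hUD hdisj hv hv0⟩
  intro a b v ha hb
  unfold Btw
  refine and_congr_right fun hv => ?_
  have h1 := key a ha
  have h2 := key b hb
  have h3 := key v hv
  omega

theorem relpos_eq (hUD : D ∪ U = Finset.Icc 1 (n + 1)) (hdisj : Disjoint D U) {a v : ℕ}
    (ha : a ≤ n + 2) (hv : v ≤ n + 2) :
    relpos n D U a v = arcLength (n + 2) (pos n D U) a v := by
  have h1 := (placement_pos hUD hdisj).pos_le a ha
  have h2 := (placement_pos hUD hdisj).pos_le v hv
  unfold relpos arcLength
  split_ifs with h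
  · rw [show pos n D U v + (n + 3) - pos n D U a = pos n D U v - pos n D U a + (n + 3) by omega,
      Nat.add_mod_right, Nat.mod_eq_of_lt (by omega)]
  · rw [Nat.mod_eq_of_lt (by omega)]

theorem strictBetween_iff (hUD : D ∪ U = Finset.Icc 1 (n + 1)) (hdisj : Disjoint D U) {a b v : ℕ}
    (ha : a ≤ n + 2) (hb : b ≤ n + 2) :
    StrictBetween n D U a b v ↔ Btw (n + 2) (pos n D U) a b v := by
  unfold StrictBetween Btw
  refine and_congr_right fun hv => ?_
  rw [relpos_eq hUD hdisj ha hv, relpos_eq hUD hdisj ha hb]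
  have h1 := (placement_pos hUD hdisj).pos_le a ha
  have h2 := (placement_pos hUD hdisj).pos_le b hb
  have h3 := (placement_pos hUD hdisj).pos_le v hv
  unfold arcLength
  split_ifs <;> omega

theorem relpos_eq_one_iff (hUD : D ∪ U = Finset.Icc 1 (n + 1)) (hdisj : Disjoint D U) {a b : ℕ}
    (ha : a ≤ n + 2) (hb : b ≤ n + 2) (hab : a ≠ b) :
    relpos n D U a b = 1 ↔ ∀ v, ¬ Btw (n + 2) (pos n D U) a b v := by
  have hP := placement_pos hUD hdisj
  have h1 := hP.pos_le a ha
  have h2 := hP.pos_le b hb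
  have hne : pos n D U a ≠ pos n D U b := fun h => hab (hP.inj ha hb h)
  constructor
  · intro h v hv
    rw [← strictBetween_iff hUD hdisj ha hb] at hv
    have := hv.2
    omega
  · intro h
    rw [relpos_eq hUD hdisj ha hb]
    by_contra hlen
    obtain ⟨v, hv, hvP⟩ := hP.surj
      (i := if pos n D U a = n + 2 then 0 else pos n D U a + 1) (by split_ifs <;> omega)
    apply h v
    unfold arcLength at hlen
    unfold Btw
    split_ifs at hlen hvP <;> omega

theorem isBoundaryEdge_iff (hUD : D ∪ U = Finset.Icc 1 (n + 1)) (hdisj : Disjoint D U) {a b : ℕ} :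
    IsBoundaryEdge n D U (a, b) ↔ a < b ∧ b ≤ n + 2 ∧
      ((∀ v, ¬ Btw (n + 2) (pos n D U) a b v) ∨ ∀ v, ¬ Btw (n + 2) (pos n D U) b a v) := by
  unfold IsBoundaryEdge IsDiag
  rw [and_assoc]
  refine and_congr_right fun h1 => and_congr_right fun h2 => ?_
  simp only at h1 h2
  rw [relpos_eq_one_iff hUD hdisj (by omega) h2 h1.ne,
    relpos_eq_one_iff hUD hdisj h2 (by omega) h1.ne']

theorem isInternalDiag_iff (hUD : D ∪ U = Finset.Icc 1 (n + 1)) (hdisj : Disjoint D U)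
    {δ : ℕ × ℕ} : IsInternalDiag n D U δ ↔ Internal (n + 2) (pos n D U) δ.1 δ.2 := by
  obtain ⟨a, b⟩ := δ
  unfold IsInternalDiag Internal
  rw [isBoundaryEdge_iff hUD hdisj]
  simp only [IsDiag, not_and, not_or, not_forall, not_not, and_assoc]
  exact ⟨fun ⟨h1, h2, h3⟩ => ⟨h1, h2, h3 h1 h2⟩, fun ⟨h1, h2, h3⟩ => ⟨h1, h2, fun _ _ => h3⟩⟩

theorem cross_iff (hUD : D ∪ U = Finset.Icc 1 (n + 1)) (hdisj : Disjoint D U) {δ δ' : ℕ × ℕ}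
    (h1 : δ.1 ≤ n + 2) (h2 : δ.2 ≤ n + 2) :
    Cross n D U δ δ' ↔ Crs (n + 2) (pos n D U) δ.1 δ.2 δ'.1 δ'.2 := by
  unfold Cross Crs
  rw [strictBetween_iff hUD hdisj h1 h2, strictBetween_iff hUD hdisj h1 h2,
    strictBetween_iff hUD hdisj h2 h1, strictBetween_iff hUD hdisj h2 h1]
  refine ⟨fun h => h.2.2.2.2.2.2, fun h => ⟨?_, ?_, ?_, ?_, ?_, ?_, h⟩⟩
  all_goals
    intro heq
    have := congrArg (pos n D U) heq
    unfold Btw at h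
    omega

theorem isTriangulation_iff (hUD : D ∪ U = Finset.Icc 1 (n + 1)) (hdisj : Disjoint D U) :
    IsTriangulation n D U T ↔ Triangulation (n + 2) (pos n D U) T := by
  constructor
  · rintro ⟨h1, h2, h3⟩
    simp only [isInternalDiag_iff hUD hdisj] at h1 h3
    refine ⟨⟨h1, fun δ hδ δ' hδ' => ?_⟩, fun a b hI hab => ?_⟩
    · have hI := h1 δ hδ
      rw [← cross_iff hUD hdisj (hI.1.trans_le hI.2.1).le hI.2.1]
      exact h2 δ hδ δ' hδ'
    · obtain ⟨δ, hδ, hc⟩ := h3 (a, b) hI hab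
      rw [cross_iff hUD hdisj (hI.1.trans_le hI.2.1).le hI.2.1] at hc
      exact ⟨δ, hδ, hc⟩
  · rintro ⟨⟨h1, h2⟩, h3⟩
    refine ⟨fun δ hδ => (isInternalDiag_iff hUD hdisj).2 (h1 δ hδ), fun δ hδ δ' hδ' => ?_,
      fun δ hI hδ => ?_⟩
    · have hI := h1 δ hδ
      rw [cross_iff hUD hdisj (hI.1.trans_le hI.2.1).le hI.2.1]
      exact h2 δ hδ δ' hδ'
    · rw [isInternalDiag_iff hUD hdisj] at hI
      obtain ⟨δ', hδ', hc⟩ := h3 δ.1 δ.2 hI hδ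
      exact ⟨δ', hδ', (cross_iff hUD hdisj (hI.1.trans_le hI.2.1).le hI.2.1).2 hc⟩

theorem mem_allTri (hUD : D ∪ U = Finset.Icc 1 (n + 1)) (hdisj : Disjoint D U) :
    T ∈ allTri n D U ↔ Triangulation (n + 2) (pos n D U) T := by
  rw [← isTriangulation_iff hUD hdisj, allTri, Finset.mem_filter, Finset.mem_powerset,
    and_iff_right_iff_imp]
  intro hT δ hδ
  have hI := hT.1 δ hδ
  have h1 := hI.1.1
  have h2 := hI.1.2
  refine Finset.mem_filter.2 ⟨Finset.mem_product.2 ⟨Finset.mem_range.2 ?_, Finset.mem_range.2 ?_⟩,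
    hI⟩ <;> omega

theorem edgeOf_iff (hUD : D ∪ U = Finset.Icc 1 (n + 1)) (hdisj : Disjoint D U)
    (hT : Dissection (n + 2) (pos n D U) T) {a b : ℕ} (hab : a < b) (hb : b ≤ n + 2) :
    EdgeOf n D U T a b ↔ Joined (n + 2) (pos n D U) T a b := by
  have hba : (b, a) ∉ T := fun h => (hT.internal _ h).1.not_gt hab
  unfold EdgeOf Joined
  rw [isBoundaryEdge_iff hUD hdisj]
  simp only [hba, hab, hb, hab.ne, (hab.trans_le hb).le, true_and, false_or, ne_eq,
    not_false_eq_true]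

theorem triWith_iff (hUD : D ∪ U = Finset.Icc 1 (n + 1)) (hdisj : Disjoint D U)
    (hT : Dissection (n + 2) (pos n D U) T) {a b c : ℕ} (hab : (a, b) ∈ T) (hc : c ≤ n + 2)
    (hca : c ≠ a) (hcb : c ≠ b) : TriWith n D U T (a, b) c ↔
      Joined (n + 2) (pos n D U) T a c ∧ Joined (n + 2) (pos n D U) T c b := by
  have hJ := Joined.of_mem hT hab
  have hlt : a < b := (hT.internal _ hab).1
  have hb := hJ.2.1
  have hcomm : ∀ x y, Joined (n + 2) (pos n D U) T x y ↔ Joined (n + 2) (pos n D U) T y x :=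
    fun x y => ⟨Joined.symm, Joined.symm⟩
  unfold TriWith IsTriangleOf
  simp only
  split_ifs with h1 h2
  · rw [edgeOf_iff hUD hdisj hT h1 (by omega), edgeOf_iff hUD hdisj hT hlt hb,
      edgeOf_iff hUD hdisj hT (h1.trans hlt) hb, hcomm a c]
    simp only [h1, hlt, hb, hJ, true_and]
  · rw [edgeOf_iff hUD hdisj hT (by omega) (by omega), edgeOf_iff hUD hdisj hT hlt hb,
      edgeOf_iff hUD hdisj hT h2 hb]
    simp only [show a < c by omega, h2, hb, hJ, true_and, and_true]
  · rw [edgeOf_iff hUD hdisj hT hlt hb, edgeOf_iff hUD hdisj hT (show b < c by omega) hc,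
      edgeOf_iff hUD hdisj hT (show a < c by omega) hc, hcomm c b]
    simp only [show b < c by omega, hlt, hc, hJ, true_and]
    exact and_comm

theorem spineSrc_eq (hUD : D ∪ U = Finset.Icc 1 (n + 1)) (hdisj : Disjoint D U)
    (hT : Dissection (n + 2) (pos n D U) T) {a b c : ℕ} (hab : (a, b) ∈ T)
    (hc : Btw (n + 2) (pos n D U) a b c) (hac : Joined (n + 2) (pos n D U) T a c)
    (hcb : Joined (n + 2) (pos n D U) T c b) : spineSrc n D U T (a, b) = midOf a b c := by
  have hJ := Joined.of_mem hT hab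
  have hex : ∃ c, StrictBetween n D U a b c ∧ TriWith n D U T (a, b) c :=
    ⟨c, (strictBetween_iff hUD hdisj hJ.1 hJ.2.1).2 hc,
      (triWith_iff hUD hdisj hT hab hc.1 hac.2.2.1.symm hcb.2.2.1).2 ⟨hac, hcb⟩⟩
  rw [spineSrc, dif_pos hex]
  obtain ⟨h1, h2⟩ := hex.choose_spec
  rw [strictBetween_iff hUD hdisj hJ.1 hJ.2.1] at h1
  rw [triWith_iff hUD hdisj hT hab h1.1 (fun h => by rw [h] at h1; unfold Btw at h1; omega)
    (fun h => by rw [h] at h1; unfold Btw at h1; omega)] at h2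
  rw [hT.apex_unique (placement_pos hUD hdisj) hJ.1 hJ.2.1 hc hac hcb h1 h2.1 h2.2]

theorem spineTgt_eq (hUD : D ∪ U = Finset.Icc 1 (n + 1)) (hdisj : Disjoint D U)
    (hT : Dissection (n + 2) (pos n D U) T) {a b d : ℕ} (hab : (a, b) ∈ T)
    (hd : Btw (n + 2) (pos n D U) b a d) (hbd : Joined (n + 2) (pos n D U) T b d)
    (hda : Joined (n + 2) (pos n D U) T d a) : spineTgt n D U T (a, b) = midOf a b d := by
  have hJ := Joined.of_mem hT hab
  have hex : ∃ d, StrictBetween n D U b a d ∧ TriWith n D U T (a, b) d :=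
    ⟨d, (strictBetween_iff hUD hdisj hJ.2.1 hJ.1).2 hd,
      (triWith_iff hUD hdisj hT hab hd.1 hda.2.2.1 hbd.2.2.1.symm).2 ⟨hda.symm, hbd.symm⟩⟩
  rw [spineTgt, dif_pos hex]
  obtain ⟨h1, h2⟩ := hex.choose_spec
  rw [strictBetween_iff hUD hdisj hJ.2.1 hJ.1] at h1
  rw [triWith_iff hUD hdisj hT hab h1.1 (fun h => by rw [h] at h1; unfold Btw at h1; omega)
    (fun h => by rw [h] at h1; unfold Btw at h1; omega)] at h2
  rw [hT.apex_unique (placement_pos hUD hdisj) hJ.2.1 hJ.1 hd hbd hda h1 h2.2.symm h2.1.symm]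

theorem spineSrc_lt_spineTgt_iff (hUD : D ∪ U = Finset.Icc 1 (n + 1)) (hdisj : Disjoint D U)
    (hT : Triangulation (n + 2) (pos n D U) T) {δ : ℕ × ℕ} (hδ : δ ∈ T) :
    spineSrc n D U T δ < spineTgt n D U T δ ↔ Ascending (n + 2) (pos n D U) T δ.1 δ.2 := by
  obtain ⟨a, b⟩ := δ
  have hP := placement_pos hUD hdisj
  have hJ := Joined.of_mem hT.toDissection hδ
  obtain ⟨c, d, hc, hd, hac, hcb, hbd, hda⟩ := hT.exists_apexes hP hδ
  rw [spineSrc_eq hUD hdisj hT.toDissection hδ hc hac hcb,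
    spineTgt_eq hUD hdisj hT.toDissection hδ hd hbd hda,
    hT.ascending_iff hP hJ.1 hJ.2.1 hc hd hac hcb hbd hda]

theorem orderedArcCount_eq (hUD : D ∪ U = Finset.Icc 1 (n + 1)) (hdisj : Disjoint D U) (ℓ : ℕ) :
    orderedArcCount n D U ℓ = ((allTri n D U).filter fun T =>
      (T.filter fun δ => Ascending (n + 2) (pos n D U) T δ.1 δ.2).card = ℓ).card := by
  unfold orderedArcCount
  congr 1
  refine Finset.filter_congr fun T hT => ?_
  rw [Finset.filter_congr fun δ hδ =>
    spineSrc_lt_spineTgt_iff hUD hdisj ((mem_allTri hUD hdisj).1 hT) hδ]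

end Bridge

/-- The number of triangulations of `P` whose spine has exactly `ℓ`
ordered arcs equals the number of triangulations whose spine has exactly `n − ℓ`
ordered arcs. -/
theorem ordered_arc_count_symmetric (n : ℕ) (hn : 1 ≤ n) (D U : Finset ℕ)
    (hUD : D ∪ U = Finset.Icc 1 (n + 1)) (hdisj : Disjoint D U)
    (ℓ : ℕ) (hℓ : ℓ ≤ n) :
    orderedArcCount n D U ℓ = orderedArcCount n D U (n - ℓ) := by
  rw [orderedArcCount_eq hUD hdisj, orderedArcCount_eq hUD hdisj]
  exact (reversed_pos hUD hdisj).card_filter_ascending (placement_pos hUD hdisj)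
    (placement_pos (by rwa [Finset.union_comm]) hdisj.symm) (by omega)
    (fun T => mem_allTri hUD hdisj) (by omega)

end Spines
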